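/- arXiv:2012.03809 — 2 statements merged into one kernel-verified Lean document; each statement's English description precedes it below -/
import Mathlib

section
/- Let Σ be an m×m real symmetric positive definite matrix with diagonal entries Σ₁₁, …, Σₘₘ and eigenvalues λ₁, …, λₘ, and let q be a real number with 0 < q < 1. Then λ₁^q + ⋯ + λₘ^q ≤ Σ₁₁^q + ⋯ + Σₘₘ^q. -/
namespace Matrix

variable {n : Type*} [Fintype n] [DecidableEq n]

theorem sum_sq_row_eq_one_of_mem_orthogonalGroup {U : Matrix n n ℝ}
    (hU : U ∈ orthogonalGroup n ℝ) (i : n) : ∑ j, U i j ^ 2 = 1 := by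
  have h := congrFun₂ (mem_orthogonalGroup_iff n ℝ |>.1 hU) i i
  simpa [mul_apply, star_apply, sq] using h

theorem sum_sq_col_eq_one_of_mem_orthogonalGroup {U : Matrix n n ℝ}
    (hU : U ∈ orthogonalGroup n ℝ) (j : n) : ∑ i, U i j ^ 2 = 1 := by
  have h := congrFun₂ (mem_orthogonalGroup_iff' n ℝ |>.1 hU) j j
  simpa [mul_apply, star_apply, sq] using h

theorem IsHermitian.diag_eq_sum_sq_mul_eigenvalues {A : Matrix n n ℝ} (hA : A.IsHermitian)
    (i : n) : A i i = ∑ j, (hA.eigenvectorUnitary : Matrix n n ℝ) i j ^ 2 * hA.eigenvalues j := by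
  have h := congrFun₂ hA.spectral_theorem i i
  rw [Unitary.conjStarAlgAut_apply, mul_apply] at h
  rw [h]
  refine Finset.sum_congr rfl fun j _ => ?_
  simp only [mul_diagonal, star_apply, star_trivial, Function.comp_apply, RCLike.ofReal_real_eq_id,
    id_eq]
  ring

/-- **Peierls' inequality**: a concave function summed over the eigenvalues of a symmetric matrix
is at most its sum over the diagonal entries. -/
theorem IsHermitian.sum_eigenvalues_le_sum_diag_of_concaveOn {A : Matrix n n ℝ}
    (hA : A.IsHermitian) {s : Set ℝ} {f : ℝ → ℝ} (hf : ConcaveOn ℝ s f)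
    (hs : ∀ i, hA.eigenvalues i ∈ s) :
    ∑ i, f (hA.eigenvalues i) ≤ ∑ i, f (A i i) := by
  let U := (hA.eigenvectorUnitary : Matrix n n ℝ)
  have hU : U ∈ orthogonalGroup n ℝ := hA.eigenvectorUnitary.2
  calc ∑ j, f (hA.eigenvalues j)
      = ∑ j, ∑ i, U i j ^ 2 * f (hA.eigenvalues j) := by
        simp_rw [← Finset.sum_mul, sum_sq_col_eq_one_of_mem_orthogonalGroup hU, one_mul]
    _ = ∑ i, ∑ j, U i j ^ 2 * f (hA.eigenvalues j) := Finset.sum_comm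
    _ ≤ ∑ i, f (A i i) := by
        refine Finset.sum_le_sum fun i _ => ?_
        rw [hA.diag_eq_sum_sq_mul_eigenvalues i]
        exact hf.le_map_sum (fun j _ => sq_nonneg (U i j))
          (sum_sq_row_eq_one_of_mem_orthogonalGroup hU i) fun j _ => hs j

end Matrix

/-- For a real symmetric positive definite `m × m` matrix `S` with
eigenvalues `λ i` and diagonal entries `S i i`, and any real `q` with `0 < q < 1`,
one has `∑ i, (λ i) ^ q ≤ ∑ i, (S i i) ^ q` (real powers). -/
theorem sum_eigenvalues_rpow_le_sum_diag_rpow {m : ℕ} (S : Matrix (Fin m) (Fin m) ℝ)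
    (hS : S.PosDef) (q : ℝ) (hq0 : 0 < q) (hq1 : q < 1) :
    ∑ i, (hS.isHermitian.eigenvalues i) ^ q ≤ ∑ i, (S i i) ^ q := by
  exact hS.isHermitian.sum_eigenvalues_le_sum_diag_of_concaveOn
    (Real.concaveOn_rpow hq0.le hq1.le) fun i => (hS.eigenvalues_pos i).le
end

section
/- Let Σ be an m×m real symmetric positive definite matrix with diagonal entries Σ₁₁, …, Σₘₘ and eigenvalues λ₁, …, λₘ, and let q be a real number with 0 < q < 1. Then λ₁^q + ⋯ + λₘ^q = Σ₁₁^q + ⋯ + Σₘₘ^q holds if and only if Σ is a diagonal matrix. -/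
namespace Matrix

variable {n : Type*} [Fintype n] [DecidableEq n]

/-- The entries of a real symmetric matrix in terms of its eigenvalues and eigenvectors. -/
lemma IsHermitian.apply_eq_sum_eigenvalues {A : Matrix n n ℝ} (hA : A.IsHermitian) (i j : n) :
    A i j = ∑ k, (hA.eigenvectorUnitary : Matrix n n ℝ) i k *
      (hA.eigenvectorUnitary : Matrix n n ℝ) j k * hA.eigenvalues k := by
  conv_lhs => rw [hA.spectral_theorem, Unitary.conjStarAlgAut_apply]
  rw [mul_apply]
  refine Finset.sum_congr rfl fun k _ => ?_
  rw [mul_diagonal, star_apply]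
  simp only [Function.comp_apply, RCLike.ofReal_real_eq_id, id_eq, star_trivial]
  ring

lemma unitaryGroup_sum_row_mul_row (U : unitaryGroup n ℝ) (i j : n) :
    ∑ k, (U : Matrix n n ℝ) i k * (U : Matrix n n ℝ) j k = (1 : Matrix n n ℝ) i j := by
  simpa [mul_apply, star_apply] using congrFun₂ (Unitary.coe_mul_star_self U) i j

lemma unitaryGroup_sum_col_mul_col (U : unitaryGroup n ℝ) (i j : n) :
    ∑ k, (U : Matrix n n ℝ) k i * (U : Matrix n n ℝ) k j = (1 : Matrix n n ℝ) i j := by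
  simpa [mul_apply, star_apply] using congrFun₂ (Unitary.coe_star_mul_self U) i j

/-- The eigenvalues of a real diagonal matrix are its diagonal entries, up to order. -/
lemma IsHermitian.map_eigenvalues_eq_of_eq_diagonal {A : Matrix n n ℝ} (hA : A.IsHermitian)
    {d : n → ℝ} (h : A = diagonal d) :
    Finset.univ.val.map hA.eigenvalues = Finset.univ.val.map d := by
  have h1 := hA.roots_charpoly_eq_eigenvalues
  have h2 : A.charpoly.roots = Finset.univ.val.map d := by
    rw [h, charpoly_diagonal]
    simpa only [Multiset.map_map] using!
      Polynomial.roots_multiset_prod_X_sub_C (Finset.univ.val.map d)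
  exact h1.symm.trans h2

/-- Equality in the Schur majorization inequality for a strictly concave function forces the
matrix to be diagonal. -/
lemma IsHermitian.eq_diagonal_of_sum_eigenvalues_eq {A : Matrix n n ℝ} (hA : A.IsHermitian)
    {s : Set ℝ} {f : ℝ → ℝ} (hf : StrictConcaveOn ℝ s f) (hs : ∀ i, hA.eigenvalues i ∈ s)
    (h : ∑ i, f (hA.eigenvalues i) = ∑ i, f (A i i)) :
    A = diagonal fun i => A i i := by
  set U := (hA.eigenvectorUnitary : Matrix n n ℝ) with hU
  have hw0 (i : n) : ∀ k ∈ Finset.univ, 0 ≤ U i k * U i k := fun k _ => mul_self_nonneg _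
  have hw1 (i : n) : ∑ k, U i k * U i k = 1 := by
    rw [hU, unitaryGroup_sum_row_mul_row, one_apply_eq]
  have hdiag (i : n) : A i i = ∑ k, (U i k * U i k) • hA.eigenvalues k :=
    hA.apply_eq_sum_eigenvalues i i
  have hle (i : n) : ∑ k, (U i k * U i k) • f (hA.eigenvalues k) ≤ f (A i i) := by
    rw [hdiag]
    exact hf.concaveOn.le_map_sum (hw0 i) (hw1 i) fun k _ => hs k
  have hsum : ∑ i, ∑ k, (U i k * U i k) • f (hA.eigenvalues k) = ∑ i, f (A i i) := by
    rw [← h, Finset.sum_comm]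
    refine Finset.sum_congr rfl fun k _ => ?_
    rw [← Finset.sum_smul, hU, unitaryGroup_sum_col_mul_col, one_apply_eq, one_smul]
  have heq (i : n) : ∑ k, (U i k * U i k) • f (hA.eigenvalues k) = f (A i i) :=
    (Finset.sum_eq_sum_iff_of_le fun i _ => hle i).1 hsum i (Finset.mem_univ i)
  have hconst (i k : n) (hk : U i k ≠ 0) : hA.eigenvalues k = A i i := by
    have := heq i
    rw [hdiag, eq_comm, hf.map_sum_eq_iff' (hw0 i) (hw1 i) fun k _ => hs k] at this
    rw [hdiag]
    exact this k (Finset.mem_univ k) (mul_self_ne_zero.2 hk)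
  ext i j
  rcases eq_or_ne i j with rfl | hij
  · simp
  rw [diagonal_apply_ne _ hij, hA.apply_eq_sum_eigenvalues]
  calc ∑ k, U i k * U j k * hA.eigenvalues k = ∑ k, U i k * U j k * A i i := by
        refine Finset.sum_congr rfl fun k _ => ?_
        by_cases hk : U i k = 0
        · simp [hk]
        · rw [hconst i k hk]
    _ = 0 := by
        rw [← Finset.sum_mul, hU, unitaryGroup_sum_row_mul_row, one_apply_ne hij,
          zero_mul]

end Matrix

/-- For a real symmetric positive definite `m × m` matrix `S` with
eigenvalues `λ i` and diagonal entries `S i i`, and any real `q` with `0 < q < 1`,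
one has `∑ i, (λ i) ^ q = ∑ i, (S i i) ^ q` (real powers) if and only if `S` is a
diagonal matrix. -/
theorem sum_eigenvalues_rpow_eq_sum_diag_rpow_iff_diagonal {m : ℕ}
    (S : Matrix (Fin m) (Fin m) ℝ) (hS : S.PosDef) (q : ℝ) (hq0 : 0 < q) (hq1 : q < 1) :
    ∑ i, (hS.isHermitian.eigenvalues i) ^ q = ∑ i, (S i i) ^ q ↔
      S = Matrix.diagonal (fun i => S i i) := by
  refine ⟨hS.isHermitian.eq_diagonal_of_sum_eigenvalues_eq
    (Real.strictConcaveOn_rpow hq0 hq1) fun i => (hS.eigenvalues_pos i).le, fun h => ?_⟩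
  have hmap := congrArg (fun M => (M.map (· ^ q)).sum)
    (hS.isHermitian.map_eigenvalues_eq_of_eq_diagonal h)
  simpa only [Multiset.map_map] using! hmap
end
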